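/- Let c1 = (c11, c12) and c2 = (c21, c22) be vectors in ℤ² with Γ := |c11·c22 − c12·c21| ≠ 0 (i.e. c1 and c2 linearly independent). Then the number N of lattice points of ℤ² lying in the triangle T = conv{(0,0), c1, c1+c2} ⊂ ℝ² satisfies 4·N ≤ 5·Γ + 7. -/

import Mathlib

/-- The set of lattice points of `ℤ²` lying in the triangle
`conv{(0,0), c1, c1+c2} ⊂ ℝ²`, where `c1 = (c11, c12)` and `c2 = (c21, c22)`. -/
def triangleLatticePoints (c11 c12 c21 c22 : ℤ) : Set (ℤ × ℤ) :=
  {q : ℤ × ℤ | ((q.1 : ℝ), (q.2 : ℝ)) ∈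
    convexHull ℝ ({((0 : ℝ), (0 : ℝ)), ((c11 : ℝ), (c12 : ℝ)),
      ((c11 : ℝ) + (c21 : ℝ), (c12 : ℝ) + (c22 : ℝ))} : Set (ℝ × ℝ))}

/-- The subgroup of `ℤ²` spanned by two linearly independent vectors has index the absolute value
of their determinant. -/
theorem natCard_quotient_span_pair (c11 c12 c21 c22 : ℤ) (h : c11 * c22 - c12 * c21 ≠ 0) :
    Nat.card ((ℤ × ℤ) ⧸ Submodule.span ℤ (Set.range ![(c11, c12), (c21, c22)])) =
      (c11 * c22 - c12 * c21).natAbs := by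
  have hli : LinearIndependent ℤ ![(c11, c12), (c21, c22)] := by
    refine LinearIndependent.pair_iff.2 fun s t hst => ?_
    simp only [Prod.smul_mk, smul_eq_mul, Prod.mk_add_mk, Prod.mk_eq_zero] at hst
    obtain ⟨h1, h2⟩ := hst
    constructor
    · refine (mul_eq_zero.1 ?_).resolve_right h
      linear_combination c22 * h1 - c21 * h2
    · refine (mul_eq_zero.1 ?_).resolve_right h
      linear_combination c11 * h2 - c12 * h1
  rw [← Submodule.natAbs_det_basis_change (Module.Basis.finTwoProd ℤ) _ (Module.Basis.span hli),
    Module.Basis.det_apply, Matrix.det_fin_two]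
  congr 1
  simp [Module.Basis.toMatrix_apply, Module.Basis.span_apply]
  ring

theorem exists_coords_of_mem_triangleLatticePoints {c11 c12 c21 c22 : ℤ} {q : ℤ × ℤ}
    (hq : q ∈ triangleLatticePoints c11 c12 c21 c22) :
    ∃ a b : ℝ, 0 ≤ b ∧ b ≤ a ∧ a ≤ 1 ∧
      (q.1 : ℝ) = a * c11 + b * c21 ∧ (q.2 : ℝ) = a * c12 + b * c22 := by
  rw [triangleLatticePoints, Set.mem_ofPred_eq, convexHull_insert (by simp), convexHull_pair,
    mem_convexJoin] at hq
  obtain ⟨_, rfl, y, ⟨u, v, hu, hv, huv, rfl⟩, ⟨s, t, hs, ht, hst, h⟩⟩ := hq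
  simp only [Prod.smul_mk, smul_eq_mul, Prod.mk_add_mk, Prod.mk.injEq] at h
  refine ⟨t, t * v, mul_nonneg ht hv, mul_le_of_le_one_right ht (by linarith), by linarith, ?_, ?_⟩
  · rw [← h.1]
    linear_combination t * c11 * huv
  · rw [← h.2]
    linear_combination t * c12 * huv

/-- Distinct lattice points of the triangle that are congruent modulo the lattice spanned by `c1`
and `c2` are vertices, so away from two of the vertices the quotient map is injective. -/
theorem injOn_mkQ_triangleLatticePoints (c11 c12 c21 c22 : ℤ)
    (h : c11 * c22 - c12 * c21 ≠ 0) :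
    Set.InjOn (Submodule.span ℤ (Set.range ![(c11, c12), (c21, c22)])).mkQ
      (triangleLatticePoints c11 c12 c21 c22 \ {(0, 0), (c11, c12)}) := by
  rintro ⟨p1, p2⟩ ⟨hp, hpv⟩ ⟨q1, q2⟩ ⟨hq, hqv⟩ hpq
  simp only [Set.mem_insert_iff, Set.mem_singleton_iff, not_or] at hpv hqv
  obtain ⟨a, b, hb, hba, ha, hp1, hp2⟩ := exists_coords_of_mem_triangleLatticePoints hp
  obtain ⟨a', b', hb', hba', ha', hq1, hq2⟩ := exists_coords_of_mem_triangleLatticePoints hq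
  rw [Submodule.mkQ_apply, Submodule.mkQ_apply, Submodule.Quotient.eq, Matrix.range_cons,
    Matrix.range_cons, Matrix.range_empty, Set.union_empty, Set.singleton_union,
    Submodule.mem_span_pair] at hpq
  obtain ⟨m, n, hmn⟩ := hpq
  simp only [Prod.smul_mk, smul_eq_mul, Prod.mk_add_mk, Prod.mk_sub_mk, Prod.mk.injEq] at hmn hpv hqv
  have e1 : (m : ℝ) * c11 + n * c21 = p1 - q1 := by exact_mod_cast hmn.1
  have e2 : (m : ℝ) * c12 + n * c22 = p2 - q2 := by exact_mod_cast hmn.2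
  have hD : (c11 * c22 - c12 * c21 : ℝ) ≠ 0 := by exact_mod_cast h
  simp only at hp1 hp2 hq1 hq2
  have hm : (m : ℝ) = a - a' := by
    refine mul_right_cancel₀ hD ?_
    linear_combination c22 * (e1 + hp1 - hq1) - c21 * (e2 + hp2 - hq2)
  have hn : (n : ℝ) = b - b' := by
    refine mul_right_cancel₀ hD ?_
    linear_combination c11 * (e2 + hp2 - hq2) - c12 * (e1 + hp1 - hq1)
  have eq_zero {x1 x2 : ℤ} {s t : ℝ} (hx1 : (x1 : ℝ) = s * c11 + t * c21)
      (hx2 : (x2 : ℝ) = s * c12 + t * c22) (hs : s = 0) (ht : t = 0) : x1 = 0 ∧ x2 = 0 := by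
    subst hs ht
    constructor <;> [rify [hx1]; rify [hx2]] <;> ring
  have eq_vertex {x1 x2 : ℤ} {s t : ℝ} (hx1 : (x1 : ℝ) = s * c11 + t * c21)
      (hx2 : (x2 : ℝ) = s * c12 + t * c22) (hs : s = 1) (ht : t = 0) : x1 = c11 ∧ x2 = c12 := by
    subst hs ht
    constructor <;> [rify [hx1]; rify [hx2]] <;> ring
  have hm0 : m = 0 := by
    rcases lt_trichotomy m 0 with hlt | rfl | hlt
    · have : (m : ℝ) ≤ -1 := by exact_mod_cast Int.le_sub_one_of_lt hlt
      exact absurd (eq_zero hp1 hp2 (by linarith) (by linarith)) hpv.1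
    · rfl
    · have : (1 : ℝ) ≤ m := by exact_mod_cast hlt
      exact absurd (eq_zero hq1 hq2 (by linarith) (by linarith)) hqv.1
  subst hm0
  rw [Int.cast_zero] at hm
  have hn0 : n = 0 := by
    rcases lt_trichotomy n 0 with hlt | rfl | hlt
    · have : (n : ℝ) ≤ -1 := by exact_mod_cast Int.le_sub_one_of_lt hlt
      exact absurd (eq_vertex hp1 hp2 (by linarith) (by linarith)) hpv.2
    · rfl
    · have : (1 : ℝ) ≤ n := by exact_mod_cast hlt
      exact absurd (eq_vertex hq1 hq2 (by linarith) (by linarith)) hqv.2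
  subst hn0
  rw [Prod.mk.injEq]
  constructor <;> linarith [hmn.1, hmn.2]

/-- The number of lattice points is at most the normalized area plus two. -/
theorem finite_and_ncard_triangleLatticePoints_le (c11 c12 c21 c22 : ℤ)
    (h : c11 * c22 - c12 * c21 ≠ 0) :
    (triangleLatticePoints c11 c12 c21 c22).Finite ∧
      (triangleLatticePoints c11 c12 c21 c22).ncard ≤ (c11 * c22 - c12 * c21).natAbs + 2 := by
  have hcard := natCard_quotient_span_pair c11 c12 c21 c22 h
  have hinj := injOn_mkQ_triangleLatticePoints c11 c12 c21 c22 h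
  have : Finite ((ℤ × ℤ) ⧸ Submodule.span ℤ (Set.range ![(c11, c12), (c21, c22)])) :=
    Nat.finite_of_card_ne_zero (by rwa [hcard, Int.natAbs_ne_zero])
  have hfin := Set.Finite.of_finite_image (Set.toFinite _) hinj
  refine ⟨hfin.of_sdiff (Set.toFinite _), ?_⟩
  calc (triangleLatticePoints c11 c12 c21 c22).ncard
      ≤ (triangleLatticePoints c11 c12 c21 c22 \ {(0, 0), (c11, c12)}).ncard +
          ({(0, 0), (c11, c12)} : Set (ℤ × ℤ)).ncard :=
        Set.ncard_le_ncard_sdiff_add_ncard _ _ (Set.toFinite _)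
    _ ≤ (c11 * c22 - c12 * c21).natAbs + 2 := by
        refine add_le_add ?_ (Set.ncard_insert_le _ _ |>.trans (by simp))
        rw [← hcard, ← hinj.ncard_image]
        exact Set.ncard_le_card _

/-- Let `c1 = (c11, c12)` and `c2 = (c21, c22)` be vectors in `ℤ²` with
`Γ := |c11·c22 − c12·c21| ≠ 0`.  Then the number `N` of lattice points of `ℤ²`
lying in the triangle `T = conv{(0,0), c1, c1+c2} ⊂ ℝ²` satisfies `4·N ≤ 5·Γ + 7`. -/
theorem four_mul_latticePoints_le (c11 c12 c21 c22 : ℤ)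
    (hΓ : (c11 * c22 - c12 * c21).natAbs ≠ 0) :
    (triangleLatticePoints c11 c12 c21 c22).Finite ∧
    4 * (triangleLatticePoints c11 c12 c21 c22).ncard ≤
      5 * (c11 * c22 - c12 * c21).natAbs + 7 := by
  have hD := Int.natAbs_ne_zero.1 hΓ
  obtain ⟨hfin, hle⟩ := finite_and_ncard_triangleLatticePoints_le c11 c12 c21 c22 hD
  exact ⟨hfin, by omega⟩
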